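/- Let σ be an ALG-schedule and σ_O any schedule of the same instance. Then at every time t ≥ 0 it holds that |Cl(t) ∖ O(t)| ≤ (1 + 1/(1−α)) · |O(t)|. -/

import Mathlib

open MeasureTheory Set

open scoped Classical

noncomputable section

variable {J : Type*}

/-- Total work done on job `j` by time `u` under the schedule `σ`. -/
def workDone (σ : ℝ → J → ℝ) (j : J) (u : ℝ) : ℝ := ∫ v in (0:ℝ)..u, σ v j

/-- Remaining processing time of job `j` at time `u`. -/
def remT (p : J → ℝ) (σ : ℝ → J → ℝ) (j : J) (u : ℝ) : ℝ := p j - workDone σ j u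

/-- Completion time of job `j`: the least `u` with `workDone σ j u = p j`,
    and `⊤` if the job never completes. -/
def cTime (p : J → ℝ) (σ : ℝ → J → ℝ) (j : J) : EReal :=
  sInf ((fun v : ℝ => (v : EReal)) '' {v : ℝ | workDone σ j v = p j})

/-- Job `j` is available at time `u`: released and not yet completed. -/
def availAt (r p : J → ℝ) (σ : ℝ → J → ℝ) (u : ℝ) (j : J) : Prop :=
  r j ≤ u ∧ (u : EReal) < cTime p σ j

/-- Job `j` is processed at time `u`. -/
def procAt (σ : ℝ → J → ℝ) (u : ℝ) (j : J) : Prop := 0 < σ u j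

/-- Job `j` is non-clairvoyant at time `u`. -/
def ncAt (r p : J → ℝ) (α : ℝ) (σ : ℝ → J → ℝ) (u : ℝ) (j : J) : Prop :=
  availAt r p σ u j ∧ workDone σ j u ≤ α * p j

/-- Job `j` is clairvoyant at time `u`. -/
def clAt (r p : J → ℝ) (α : ℝ) (σ : ℝ → J → ℝ) (u : ℝ) (j : J) : Prop :=
  availAt r p σ u j ∧ α * p j < workDone σ j u

/-- The time at which job `j` emits its signal: the least `u` with
    `workDone σ j u = α * p j`. -/
def emitT (p : J → ℝ) (α : ℝ) (σ : ℝ → J → ℝ) (j : J) : ℝ :=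
  sInf {u : ℝ | workDone σ j u = α * p j}

/-- Data of an instance: nonnegative release dates, positive processing times
    and `α ∈ (0,1)`. -/
structure IsInstance (r p : J → ℝ) (α : ℝ) : Prop where
  r_nonneg : ∀ j, 0 ≤ r j
  p_pos : ∀ j, 0 < p j
  alpha_mem : α ∈ Set.Ioo (0 : ℝ) 1

/-- `σ` is a (feasible, preemptive, single machine) schedule. -/
structure IsSchedule [Fintype J] (r p : J → ℝ) (σ : ℝ → J → ℝ) : Prop where
  meas : ∀ j, Measurable fun u => σ u j
  nonneg : ∀ u j, 0 ≤ σ u j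
  sum_le_one : ∀ u, ∑ j, σ u j ≤ 1
  zero_before_release : ∀ u j, u < r j → σ u j = 0
  workDone_le : ∀ u j, workDone σ j u ≤ p j

/-- A schedule is non-idling if it uses the full machine capacity whenever
    some job is available. -/
def NonIdling [Fintype J] (r p : J → ℝ) (σ : ℝ → J → ℝ) : Prop :=
  ∀ u, (∃ j, availAt r p σ u j) → ∑ j, σ u j = 1

/-- The SRPT condition at time `u`: `Cl(u) ≠ ∅` and
    `min_{j ∈ Cl(u)} p_j(u) ≤ ((1-α)/α) · min_{j ∈ N(u)} y_j(u)`
    (the minimum over the empty set being `+∞`). -/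
def SrptCond (r p : J → ℝ) (α : ℝ) (σ : ℝ → J → ℝ) (u : ℝ) : Prop :=
  ∃ k, clAt r p α σ u k ∧
    ∀ j, ncAt r p α σ u j → remT p σ k u ≤ ((1 - α) / α) * workDone σ j u

/-- `k` is a clairvoyant job of minimal remaining processing time at `u`,
    emitting last among those. -/
def IsSrptChoice (r p : J → ℝ) (α : ℝ) (σ : ℝ → J → ℝ) (u : ℝ) (k : J) : Prop :=
  clAt r p α σ u k ∧
    (∀ j, clAt r p α σ u j → remT p σ k u ≤ remT p σ j u) ∧
    (∀ j, clAt r p α σ u j → remT p σ j u = remT p σ k u →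
      emitT p α σ j ≤ emitT p α σ k)

/-- `j` is a non-clairvoyant job with minimal progress at time `u`. -/
def IsMinNc (r p : J → ℝ) (α : ℝ) (σ : ℝ → J → ℝ) (u : ℝ) (j : J) : Prop :=
  ncAt r p α σ u j ∧ ∀ j', ncAt r p α σ u j' → workDone σ j u ≤ workDone σ j' u

/-- `σ` is an ALG-schedule: non-idling, and at any time with available jobs it
    either runs a single clairvoyant job of shortest remaining processing time
    (breaking ties by latest emission) when the SRPT condition holds, or it runs
    exactly the non-clairvoyant jobs of minimal progress at equal rates. -/
structure IsALG [Fintype J] (r p : J → ℝ) (α : ℝ) (σ : ℝ → J → ℝ) : Prop where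
  sched : IsSchedule r p σ
  nonidling : NonIdling r p σ
  srpt_branch : ∀ u, (∃ j, availAt r p σ u j) → SrptCond r p α σ u →
    ∃ k, IsSrptChoice r p α σ u k ∧ ∀ j, j ≠ k → σ u j = 0
  setf_branch : ∀ u, (∃ j, availAt r p σ u j) → ¬ SrptCond r p α σ u →
    (∀ j, procAt σ u j → IsMinNc r p α σ u j) ∧
    (∀ j j', IsMinNc r p α σ u j → IsMinNc r p α σ u j' → σ u j = σ u j')

/-- Right endpoint `min (C_j, t)` of the lifetime of `j` w.r.t. reference time `t`. -/
def lifeEnd (p : J → ℝ) (σ : ℝ → J → ℝ) (t : ℝ) (j : J) : ℝ :=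
  (min (cTime p σ j) (t : EReal)).toReal

/-- The lifetime `I_j = [r j, min (C_j, t)]` of job `j`. -/
def lifetime (r p : J → ℝ) (σ : ℝ → J → ℝ) (t : ℝ) (j : J) : Set ℝ :=
  Set.Icc (r j) (lifeEnd p σ t j)

/-- `E_N`-edge of the borrow graph: `i` is processed at some time of `I_j`
    while being non-clairvoyant. -/
def ENedge (r p : J → ℝ) (α : ℝ) (σ : ℝ → J → ℝ) (t : ℝ) (j i : J) : Prop :=
  ∃ u ∈ lifetime r p σ t j, procAt σ u i ∧ ncAt r p α σ u i

/-- `E_C`-edge of the borrow graph: `i` is processed at some time of `I_j`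
    while being clairvoyant. -/
def ECedge (r p : J → ℝ) (α : ℝ) (σ : ℝ → J → ℝ) (t : ℝ) (j i : J) : Prop :=
  ∃ u ∈ lifetime r p σ t j, procAt σ u i ∧ clAt r p α σ u i

/-- Edge of the borrow graph `G_B`. -/
def borrowEdge (r p : J → ℝ) (α : ℝ) (σ : ℝ → J → ℝ) (t : ℝ) (j i : J) : Prop :=
  ENedge r p α σ t j i ∨ ECedge r p α σ t j i

/-- `reaches j i` iff `i ∈ R_j`, i.e. `i` is reachable from `j` in the borrow
    graph (`j` itself included). -/
def reaches (r p : J → ℝ) (α : ℝ) (σ : ℝ → J → ℝ) (t : ℝ) : J → J → Prop :=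
  Relation.ReflTransGen (borrowEdge r p α σ t)

/-- Truncated progress `ȳ_j = min (y_j(t), α p_j)`. -/
def truncY (p : J → ℝ) (α : ℝ) (σ : ℝ → J → ℝ) (t : ℝ) (j : J) : ℝ :=
  min (workDone σ j t) (α * p j)

end

namespace IsSchedule

variable {J : Type*} [Fintype J] {r p : J → ℝ} {σ : ℝ → J → ℝ}

theorem le_one (h : IsSchedule r p σ) (u : ℝ) (j : J) : σ u j ≤ 1 :=
  (Finset.single_le_sum (fun i _ => h.nonneg u i) (Finset.mem_univ j)).trans (h.sum_le_one u)

theorem intervalIntegrable (h : IsSchedule r p σ) (j : J) (a b : ℝ) :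
    IntervalIntegrable (fun u => σ u j) volume a b :=
  (intervalIntegrable_const (c := (1 : ℝ))).mono_fun (h.meas j).aestronglyMeasurable
    (Filter.Eventually.of_forall fun u => by
      simpa [abs_of_nonneg (h.nonneg u j)] using h.le_one u j)

theorem workDone_sub (h : IsSchedule r p σ) (j : J) (a b : ℝ) :
    workDone σ j b - workDone σ j a = ∫ u in a..b, σ u j :=
  intervalIntegral.integral_interval_sub_left (h.intervalIntegrable j 0 b)
    (h.intervalIntegrable j 0 a)

theorem workDone_mono (h : IsSchedule r p σ) (j : J) : Monotone (workDone σ j) := by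
  intro a b hab
  have h1 := h.workDone_sub j a b
  have h2 : 0 ≤ ∫ u in a..b, σ u j :=
    intervalIntegral.integral_nonneg_of_forall hab fun u => h.nonneg u j
  linarith

theorem workDone_continuous (h : IsSchedule r p σ) (j : J) : Continuous (workDone σ j) :=
  intervalIntegral.continuous_primitive (fun a b => h.intervalIntegrable j a b) 0

/-- A job that is never processed strictly between `a` and `b` makes no progress there. -/
theorem workDone_eq_of_idle (h : IsSchedule r p σ) {j : J} {a b : ℝ} (hab : a ≤ b)
    (hz : ∀ u ∈ Ioo a b, σ u j = 0) : workDone σ j b = workDone σ j a := by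
  have h1 := h.workDone_sub j a b
  have h2 : ∫ u in a..b, σ u j = ∫ _ in a..b, (0 : ℝ) :=
    intervalIntegral.integral_congr_Ioo_of_le hab hz
  rw [h2, intervalIntegral.integral_zero] at h1
  linarith

theorem exists_procAt (h : IsSchedule r p σ) {j : J} {a b : ℝ}
    (hlt : workDone σ j a < workDone σ j b) : ∃ u ∈ Ioo a b, procAt σ u j := by
  have hab : a ≤ b := by
    by_contra! hc
    exact absurd (h.workDone_mono j hc.le) (not_le.2 hlt)
  by_contra! hc
  refine hlt.ne' (h.workDone_eq_of_idle hab fun u hu => ?_)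
  exact le_antisymm (not_lt.1 (hc u hu)) (h.nonneg u j)

theorem workDone_eq_zero (h : IsSchedule r p σ) {j : J} (hr : 0 ≤ r j) {u : ℝ} (hu : u ≤ r j) :
    workDone σ j u = 0 := by
  have h0 : workDone σ j 0 = 0 := by simp [workDone]
  rcases le_total u 0 with hu0 | hu0
  · rw [← h0]
    refine (h.workDone_eq_of_idle hu0 fun v hv => ?_).symm
    exact h.zero_before_release v j (hv.2.trans_le hr)
  · rw [← h0]
    exact h.workDone_eq_of_idle hu0 fun v hv => h.zero_before_release v j (hv.2.trans_le hu)

theorem workDone_nonneg (h : IsSchedule r p σ) {j : J} (hr : 0 ≤ r j) (u : ℝ) :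
    0 ≤ workDone σ j u := by
  rcases le_total u (r j) with hu | hu
  · rw [h.workDone_eq_zero hr hu]
  · rw [← h.workDone_eq_zero hr le_rfl]
    exact h.workDone_mono j hu

theorem release_lt (h : IsSchedule r p σ) {j : J} (hr : 0 ≤ r j) {u : ℝ}
    (hu : 0 < workDone σ j u) : r j < u := by
  by_contra! hc
  exact hu.ne' (h.workDone_eq_zero hr hc)

theorem lt_cTime_iff (h : IsSchedule r p σ) (j : J) (u : ℝ) :
    (u : EReal) < cTime p σ j ↔ workDone σ j u < p j := by
  constructor
  · intro hu
    refine lt_of_le_of_ne (h.workDone_le u j) fun he => ?_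
    exact absurd (sInf_le ⟨u, he, rfl⟩ : cTime p σ j ≤ (u : EReal)) (not_le.2 hu)
  · intro hu
    obtain ⟨v, huv, hv⟩ : ∃ v, u < v ∧ workDone σ j v < p j := by
      have h1 : ∀ᶠ v in nhdsWithin u (Ioi u), workDone σ j v < p j :=
        ((h.workDone_continuous j).continuousAt.eventually_lt continuousAt_const hu).filter_mono
          nhdsWithin_le_nhds
      obtain ⟨v, hv, hv'⟩ := (h1.and self_mem_nhdsWithin).exists
      exact ⟨v, hv', hv⟩
    refine (EReal.coe_lt_coe_iff.2 huv).trans_le (le_sInf ?_)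
    rintro _ ⟨w, hw, rfl⟩
    refine EReal.coe_le_coe_iff.2 ?_
    by_contra! hc
    exact absurd (h.workDone_mono j hc.le) (not_le.2 (hv.trans_eq (Eq.symm hw)))

theorem availAt_iff (h : IsSchedule r p σ) (u : ℝ) (j : J) :
    availAt r p σ u j ↔ r j ≤ u ∧ workDone σ j u < p j := by
  rw [availAt, h.lt_cTime_iff]

theorem clAt_iff (h : IsSchedule r p σ) (hr : ∀ j, 0 ≤ r j) (hp : ∀ j, 0 < p j) {α : ℝ}
    (hα : 0 < α) (u : ℝ) (j : J) :
    clAt r p α σ u j ↔ α * p j < workDone σ j u ∧ workDone σ j u < p j := by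
  rw [clAt, h.availAt_iff]
  constructor
  · rintro ⟨⟨_, h2⟩, h3⟩
    exact ⟨h3, h2⟩
  · rintro ⟨h3, h2⟩
    exact ⟨⟨(h.release_lt (hr j) ((mul_pos hα (hp j)).trans h3)).le, h2⟩, h3⟩

theorem sum_workDone_sub (h : IsSchedule r p σ) (s : Finset J) (a b : ℝ) :
    ∑ j ∈ s, (workDone σ j b - workDone σ j a) = ∫ u in a..b, ∑ j ∈ s, σ u j := by
  rw [intervalIntegral.integral_finsetSum fun j _ => h.intervalIntegrable j a b]
  exact Finset.sum_congr rfl fun j _ => h.workDone_sub j a b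

/-- Jobs released at or after `a` receive at most `b - a` units of work by time `b`. -/
theorem sum_workDone_le (h : IsSchedule r p σ) (hr : ∀ j, 0 ≤ r j) {s : Finset J} {a b : ℝ}
    (hab : a ≤ b) (hs : ∀ j ∈ s, a ≤ r j) : ∑ j ∈ s, workDone σ j b ≤ b - a := by
  have h1 : ∑ j ∈ s, workDone σ j b = ∑ j ∈ s, (workDone σ j b - workDone σ j a) :=
    Finset.sum_congr rfl fun j hj => by rw [h.workDone_eq_zero (hr j) (hs j hj), sub_zero]
  have hint : IntervalIntegrable (fun u => ∑ j ∈ s, σ u j) volume a b := by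
    simpa only [Finset.sum_fn] using
      IntervalIntegrable.sum s fun j _ => h.intervalIntegrable j a b
  have h2 : ∫ u in a..b, ∑ j ∈ s, σ u j ≤ ∫ _ in a..b, (1 : ℝ) := by
    refine intervalIntegral.integral_mono_on hab hint intervalIntegrable_const fun u _ => ?_
    exact (Finset.sum_le_sum_of_subset_of_nonneg (Finset.subset_univ s)
      fun j _ _ => h.nonneg u j).trans (h.sum_le_one u)
  rw [h1, h.sum_workDone_sub]
  simpa using h2

/-- If the machine is busy throughout `(a, b)` and jobs released before `a` make no progress,
then the jobs released from time `a` on receive at least `b - a` units of work. -/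
theorem sub_le_sum_workDone (h : IsSchedule r p σ) (hr : ∀ j, 0 ≤ r j) {a b : ℝ} (hab : a ≤ b)
    (hbusy : ∀ u ∈ Ioo a b, ∑ j, σ u j = 1)
    (hold : ∀ j, r j < a → workDone σ j b = workDone σ j a) :
    b - a ≤ ∑ j with a ≤ r j, workDone σ j b := by
  have h1 : ∑ j, (workDone σ j b - workDone σ j a) = b - a := by
    rw [h.sum_workDone_sub, intervalIntegral.integral_congr_Ioo_of_le (g := fun _ => (1 : ℝ)) hab
      hbusy]
    simp
  rw [← h1, ← Finset.sum_filter_add_sum_filter_not Finset.univ (fun j => a ≤ r j)]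
  have h2 : ∑ j with ¬ a ≤ r j, (workDone σ j b - workDone σ j a) = 0 :=
    Finset.sum_eq_zero fun j hj => by
      rw [hold j (not_le.1 (Finset.mem_filter.1 hj).2), sub_self]
  rw [h2, add_zero]
  exact Finset.sum_le_sum fun j _ => sub_le_self _ (h.workDone_nonneg (hr j) a)

/-- Two jobs that progress in parallel without ever being processed simultaneously do not
progress at all. -/
theorem workDone_eq_of_parallel (h : IsSchedule r p σ) {j k : J} {a b : ℝ} (hab : a ≤ b)
    (hpar : ∀ u ∈ Ioo a b,
      workDone σ j u - workDone σ k u = workDone σ j a - workDone σ k a)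
    (hex : ∀ u ∈ Ioo a b, σ u j = 0 ∨ σ u k = 0) : workDone σ k b = workDone σ k a := by
  have hz : ∀ᵐ u, u ∈ uIoc a b → σ u k = 0 := by
    have hb : ∀ᵐ u : ℝ, u ≠ b := by simp [ae_iff, measure_singleton]
    filter_upwards [(h.intervalIntegrable j a b).ae_hasDerivAt_integral,
      (h.intervalIntegrable k a b).ae_hasDerivAt_integral, hb] with u hj hk hub hu
    rw [uIoc_of_le hab] at hu
    have hu' : u ∈ Ioo a b := ⟨hu.1, lt_of_le_of_ne hu.2 hub⟩
    have hmem : u ∈ uIcc a b := by rw [uIcc_of_le hab]; exact Ioc_subset_Icc_self hu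
    have hdj := hj hmem a left_mem_uIcc
    have hdk := hk hmem a left_mem_uIcc
    have heq : (fun x => ∫ v in a..x, σ v j) =ᶠ[nhds u] fun x => ∫ v in a..x, σ v k := by
      filter_upwards [Ioo_mem_nhds hu'.1 hu'.2] with x hx
      rw [← h.workDone_sub, ← h.workDone_sub]
      linarith [hpar x hx]
    have he : σ u j = σ u k := (hdj.congr_of_eventuallyEq heq.symm).unique hdk
    rcases hex u hu' with h0 | h0
    · rw [← he, h0]
    · exact h0
  have h1 := h.workDone_sub k a b
  rw [intervalIntegral.integral_zero_ae hz] at h1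
  linarith

end IsSchedule

/-- The time from which job `k` makes no further progress up to time `t`: the least `u` with
`workDone σ k u = workDone σ k t`. -/
noncomputable def settleTime {J : Type*} (σ : ℝ → J → ℝ) (t : ℝ) (k : J) : ℝ :=
  sInf {u : ℝ | workDone σ k u = workDone σ k t}

theorem IsInstance.workDone_pos {J : Type*} {r p : J → ℝ} {α : ℝ} {σ : ℝ → J → ℝ}
    (hinst : IsInstance r p α) {u : ℝ} {j : J} (h : clAt r p α σ u j) : 0 < workDone σ j u :=
  (mul_pos hinst.alpha_mem.1 (hinst.p_pos j)).trans h.2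

namespace IsSchedule

variable {J : Type*} [Fintype J] {r p : J → ℝ} {σ : ℝ → J → ℝ}

theorem bddBelow_settle (h : IsSchedule r p σ) {t : ℝ} {k : J} (hr : 0 ≤ r k)
    (hpos : 0 < workDone σ k t) : BddBelow {u : ℝ | workDone σ k u = workDone σ k t} :=
  ⟨r k, fun _ hu => (h.release_lt hr (hpos.trans_eq (Eq.symm hu))).le⟩

theorem workDone_settleTime (h : IsSchedule r p σ) {t : ℝ} {k : J} (hr : 0 ≤ r k)
    (hpos : 0 < workDone σ k t) : workDone σ k (settleTime σ t k) = workDone σ k t :=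
  IsClosed.csInf_mem (isClosed_eq (h.workDone_continuous k) continuous_const) ⟨t, rfl⟩
    (h.bddBelow_settle hr hpos)

theorem settleTime_le (h : IsSchedule r p σ) {t u : ℝ} {k : J} (hr : 0 ≤ r k)
    (hpos : 0 < workDone σ k t) (hu : workDone σ k u = workDone σ k t) : settleTime σ t k ≤ u :=
  csInf_le (h.bddBelow_settle hr hpos) hu

theorem workDone_lt_of_lt_settleTime (h : IsSchedule r p σ) {t u : ℝ} {k : J} (hr : 0 ≤ r k)
    (hpos : 0 < workDone σ k t) (hu : u < settleTime σ t k) :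
    workDone σ k u < workDone σ k t := by
  refine lt_of_le_of_ne ?_ fun he => absurd (h.settleTime_le hr hpos he) (not_le.2 hu)
  exact h.workDone_mono k (hu.le.trans (h.settleTime_le hr hpos rfl))

end IsSchedule

namespace IsALG

variable {J : Type*} [Fintype J] {r p : J → ℝ} {α : ℝ} {σ : ℝ → J → ℝ}

theorem clAt_iff (hinst : IsInstance r p α) (halg : IsALG r p α σ) (u : ℝ) (j : J) :
    clAt r p α σ u j ↔ α * p j < workDone σ j u ∧ workDone σ j u < p j :=
  halg.sched.clAt_iff hinst.r_nonneg hinst.p_pos hinst.alpha_mem.1 u j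

/-- A job processed at a busy time either is the unique SRPT job or has minimal progress among
the non-clairvoyant jobs while the SRPT condition fails. -/
theorem procAt_cases (halg : IsALG r p α σ) {u : ℝ} {j : J}
    (hav : ∃ i, availAt r p σ u i) (hj : procAt σ u j) :
    (SrptCond r p α σ u ∧ IsSrptChoice r p α σ u j ∧ ∀ i, i ≠ j → σ u i = 0) ∨
      (¬ SrptCond r p α σ u ∧ IsMinNc r p α σ u j) := by
  by_cases hs : SrptCond r p α σ u
  · obtain ⟨k, hk, hz⟩ := halg.srpt_branch u hav hs
    have hjk : j = k := by
      by_contra hne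
      exact (ne_of_gt hj) (hz j hne)
    subst hjk
    exact Or.inl ⟨hs, hk, hz⟩
  · exact Or.inr ⟨hs, (halg.setf_branch u hav hs).1 j hj⟩

/-- A clairvoyant job `k` blocks a job `j` with more remaining work, provided that `j` is
clairvoyant or the SRPT rule prefers `k` to `j`. -/
theorem blocked (hinst : IsInstance r p α) (halg : IsALG r p α σ) {v t : ℝ} {j k : J}
    (hvt : v ≤ t) (hk : clAt r p α σ v k) (hkt : workDone σ k t < p k)
    (hlt : remT p σ k v < remT p σ j v)
    (hnc : workDone σ j v ≤ α * p j → remT p σ k v ≤ (1 - α) / α * workDone σ j v) :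
    workDone σ j t = workDone σ j v := by
  have hs := halg.sched
  have hmono := hs.workDone_mono
  have hα := hinst.alpha_mem
  have hpos : 0 < (1 - α) / α := div_pos (sub_pos.2 hα.2) hα.1
  have hclk : ∀ u ∈ Icc v t, clAt r p α σ u k := fun u hu =>
    (halg.clAt_iff hinst u k).2 ⟨hk.2.trans_le (hmono k hu.1), (hmono k hu.2).trans_lt hkt⟩
  have key : ∀ c ∈ Icc v t, (∀ u ∈ Ioo v c, remT p σ k u < remT p σ j u) →
      workDone σ j c = workDone σ j v := by
    intro c hc hf
    refine hs.workDone_eq_of_idle hc.1 fun u hu => ?_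
    have huk := hclk u ⟨hu.1.le, hu.2.le.trans hc.2⟩
    by_contra hne
    have hproc : procAt σ u j := lt_of_le_of_ne (hs.nonneg u j) (Ne.symm hne)
    rcases halg.procAt_cases ⟨k, huk.1⟩ hproc with h | h
    · exact absurd (h.2.1.2.1 k huk) (not_le.2 (hf u hu))
    · refine h.1 ⟨k, huk, fun i hi => ?_⟩
      have h1 := hmono k hu.1.le
      have h2 := hnc ((hmono j hu.1.le).trans h.2.1.2)
      have h3 : workDone σ j v ≤ workDone σ i u := (hmono j hu.1.le).trans (h.2.2 i hi)
      have h4 := mul_le_mul_of_nonneg_left h3 hpos.le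
      unfold remT at *
      linarith
  have hcont : Continuous fun u => remT p σ j u - remT p σ k u := by
    have h1 := hs.workDone_continuous j
    have h2 := hs.workDone_continuous k
    unfold remT
    fun_prop
  by_cases hall : ∀ u ∈ Ioo v t, remT p σ k u < remT p σ j u
  · exact key t ⟨hvt, le_rfl⟩ hall
  · exfalso
    push Not at hall
    obtain ⟨w, hw, hwle⟩ := hall
    set S := {u : ℝ | remT p σ j u - remT p σ k u ≤ 0} ∩ Icc v t with hS
    have hclosed : IsClosed S :=
      (isClosed_le hcont continuous_const).inter isClosed_Icc
    have hbdd : BddBelow S := ⟨v, fun u hu => hu.2.1⟩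
    have hmem : sInf S ∈ S :=
      hclosed.csInf_mem ⟨w, sub_nonpos.2 hwle, hw.1.le, hw.2.le⟩ hbdd
    have h1 := key (sInf S) hmem.2 fun u hu => by
      by_contra! hc
      have := csInf_le hbdd
        (show u ∈ S from ⟨sub_nonpos.2 hc, hu.1.le, hu.2.le.trans hmem.2.2⟩)
      exact absurd this (not_le.2 hu.2)
    have h2 := hmono k hmem.2.1
    have h3 : remT p σ j (sInf S) - remT p σ k (sInf S) ≤ 0 := hmem.1
    unfold remT at *
    linarith

/-- Before a clairvoyant job `k` settles, it blocks every other unfinished job `j`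
released earlier. -/
theorem exists_blocking_time (hinst : IsInstance r p α) (halg : IsALG r p α σ) {t : ℝ} {j k : J}
    (hk : clAt r p α σ t k) (hjk : j ≠ k) (hrj : r j < settleTime σ t k)
    (hj : workDone σ j (settleTime σ t k) < p j) :
    ∃ v < settleTime σ t k, clAt r p α σ v k ∧ remT p σ k v < remT p σ j v ∧
      (workDone σ j v ≤ α * p j → remT p σ k v ≤ (1 - α) / α * workDone σ j v) := by
  have hs := halg.sched
  have hmono := hs.workDone_mono
  have hα := hinst.alpha_mem
  have hpos : 0 < (1 - α) / α := div_pos (sub_pos.2 hα.2) hα.1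
  have hypos := hinst.workDone_pos hk
  have hkt := ((halg.clAt_iff hinst t k).1 hk).2
  set T := settleTime σ t k with hT
  have hTk : workDone σ k T = workDone σ k t :=
    hs.workDone_settleTime (hinst.r_nonneg k) hypos
  have hlt : ∀ u < T, workDone σ k u < workDone σ k t := fun u hu =>
    hs.workDone_lt_of_lt_settleTime (hinst.r_nonneg k) hypos hu
  have hTt : T ≤ t := hs.settleTime_le (hinst.r_nonneg k) hypos rfl
  have happ : ∀ x < workDone σ k t, ∀ a < T, ∃ u ∈ Ioo a T, x < workDone σ k u := by
    intro x hx a ha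
    have h1 : ∀ᶠ u in nhdsWithin T (Iio T), x < workDone σ k u :=
      (continuousAt_const.eventually_lt (hs.workDone_continuous k).continuousAt
        (hx.trans_eq hTk.symm)).filter_mono nhdsWithin_le_nhds
    obtain ⟨u, hu, hu'⟩ := (h1.and (Ioo_mem_nhdsLT ha)).exists
    exact ⟨u, hu', hu⟩
  obtain ⟨v₀, hv₀, hclv₀⟩ := happ (α * p k) hk.2 (r j) hrj
  have hcl : ∀ u, v₀ ≤ u → u ≤ T → clAt r p α σ u k := fun u h1 h2 =>
    (halg.clAt_iff hinst u k).2
      ⟨hclv₀.trans_le (hmono k h1), ((hmono k h2).trans_eq hTk).trans_lt hkt⟩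
  by_cases hcase : ∃ v₁ ∈ Ico v₀ T, α * p j < workDone σ j v₁
  · obtain ⟨v₁, hv₁, hv₁j⟩ := hcase
    have hclj : ∀ u, v₁ ≤ u → u ≤ T → clAt r p α σ u j := fun u h1 h2 =>
      (halg.clAt_iff hinst u j).2 ⟨hv₁j.trans_le (hmono j h1), (hmono j h2).trans_lt hj⟩
    by_contra! hno
    have hle : ∀ u ∈ Ico v₁ T, remT p σ j u ≤ remT p σ k u := by
      intro u hu
      by_contra! hc
      have h1 := hno u hu.2 (hcl u (hv₁.1.trans hu.1) hu.2.le) hc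
      exact absurd h1.1 (not_le.2 (hv₁j.trans_le (hmono j hu.1)))
    have hge : ∀ u ∈ Ico v₁ T, remT p σ k u ≤ remT p σ j u := by
      intro u hu
      by_contra! hc
      have h1 := halg.blocked hinst hu.2.le (hclj u hu.1 hu.2.le) hj hc fun h =>
        absurd h (not_le.2 (hcl u (hv₁.1.trans hu.1) hu.2.le).2)
      exact absurd (h1.symm.trans hTk) (hlt u hu.2).ne
    have h1 : workDone σ k T = workDone σ k v₁ := by
      refine hs.workDone_eq_of_parallel (j := j) hv₁.2.le (fun u hu => ?_) fun u hu => ?_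
      · have h1 := hle u ⟨hu.1.le, hu.2⟩
        have h2 := hge u ⟨hu.1.le, hu.2⟩
        have h3 := hle v₁ ⟨le_rfl, hv₁.2⟩
        have h4 := hge v₁ ⟨le_rfl, hv₁.2⟩
        unfold remT at *
        linarith
      · by_contra! hne
        have hp : procAt σ u k := lt_of_le_of_ne (hs.nonneg u k) (Ne.symm hne.2)
        have hku := hcl u (hv₁.1.trans hu.1.le) hu.2.le
        rcases halg.procAt_cases ⟨k, hku.1⟩ hp with h | h
        · exact hne.1 (h.2.2 j hjk)
        · exact absurd h.2.1.2 (not_le.2 hku.2)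
    exact absurd (h1.symm.trans hTk) (hlt v₁ hv₁.2).ne
  · push Not at hcase
    obtain ⟨v, hv, hproc⟩ := hs.exists_procAt (j := k) (a := v₀) (b := T)
      ((hlt v₀ hv₀.2).trans_eq hTk.symm)
    have hkv := hcl v hv.1.le hv.2.le
    have hcond : remT p σ k v ≤ (1 - α) / α * workDone σ j v := by
      rcases halg.procAt_cases ⟨k, hkv.1⟩ hproc with h | h
      · obtain ⟨i, hi, hi'⟩ := h.1
        refine (h.2.1.2.1 i hi).trans (hi' j ⟨?_, hcase v ⟨hv.1.le, hv.2⟩⟩)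
        exact (hs.availAt_iff v j).2 ⟨(hv₀.1.trans hv.1).le, (hmono j hv.2.le).trans_lt hj⟩
      · exact absurd h.2.1.2 (not_le.2 hkv.2)
    obtain ⟨w, hw, hwk⟩ := happ (workDone σ k v) (hlt v hv.2) v hv.2
    have h1 := hcase w ⟨(hv.1.trans hw.1).le, hw.2⟩
    have h2 := mul_le_mul_of_nonneg_left (hmono j hw.1.le) hpos.le
    have h3 : (1 - α) / α * workDone σ j w ≤ (1 - α) * p j := by
      have := mul_le_mul_of_nonneg_left h1 hpos.le
      have he : (1 - α) / α * (α * p j) = (1 - α) * p j := by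
        field_simp [hα.1.ne']
      linarith
    refine ⟨w, hw.2, hcl w (hv.1.trans hw.1).le hw.2.le, ?_, fun _ => ?_⟩ <;>
      unfold remT at * <;> linarith

/-- After the settling time of a clairvoyant job, jobs released before it make no progress. -/
theorem workDone_eq_of_release_lt (hinst : IsInstance r p α) (halg : IsALG r p α σ) {t : ℝ}
    {j k : J} (hk : clAt r p α σ t k) (hrj : r j < settleTime σ t k) :
    workDone σ j t = workDone σ j (settleTime σ t k) := by
  have hs := halg.sched
  have hypos := hinst.workDone_pos hk
  have hTt := hs.settleTime_le (hinst.r_nonneg k) hypos rfl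
  rcases eq_or_ne j k with rfl | hjk
  · exact (hs.workDone_settleTime (hinst.r_nonneg j) hypos).symm
  rcases (hs.workDone_le (settleTime σ t k) j).lt_or_eq with hj | hj
  · obtain ⟨v, hv, hvk, hlt, hnc⟩ := halg.exists_blocking_time hinst hk hjk hrj hj
    have hkt := ((halg.clAt_iff hinst t k).1 hk).2
    have h1 := halg.blocked hinst (hv.le.trans hTt) hvk hkt hlt hnc
    exact le_antisymm (h1.trans_le (hs.workDone_mono j hv.le)) (hs.workDone_mono j hTt)
  · exact le_antisymm ((hs.workDone_le t j).trans_eq hj.symm) (hs.workDone_mono j hTt)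

/-- An unfinished job released before the settling time of a clairvoyant job `k` has more
remaining work than `k`. -/
theorem remT_lt_of_release_lt (hinst : IsInstance r p α) (halg : IsALG r p α σ) {t : ℝ}
    {j k : J} (hk : clAt r p α σ t k) (hjk : j ≠ k) (hrj : r j < settleTime σ t k)
    (hj : workDone σ j t < p j) : remT p σ k t < remT p σ j t := by
  have hs := halg.sched
  have hypos := hinst.workDone_pos hk
  have hTt := hs.settleTime_le (hinst.r_nonneg k) hypos rfl
  obtain ⟨v, hv, hvk, hlt, hnc⟩ := halg.exists_blocking_time hinst hk hjk hrj
    ((hs.workDone_mono j hTt).trans_lt hj)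
  have hkt := ((halg.clAt_iff hinst t k).1 hk).2
  have h1 := halg.blocked hinst (hv.le.trans hTt) hvk hkt hlt hnc
  have h2 := hs.workDone_mono k (hv.le.trans hTt)
  unfold remT at *
  linarith

theorem release_lt_settleTime (hinst : IsInstance r p α) (halg : IsALG r p α σ) {t : ℝ} {k : J}
    (hk : clAt r p α σ t k) : r k < settleTime σ t k := by
  have hypos := hinst.workDone_pos hk
  refine halg.sched.release_lt (hinst.r_nonneg k) ?_
  rwa [halg.sched.workDone_settleTime (hinst.r_nonneg k) hypos]

/-- Clairvoyant jobs settling later are released after the earlier ones settled. -/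
theorem settleTime_le_release (hinst : IsInstance r p α) (halg : IsALG r p α σ) {t : ℝ} {j k : J}
    (hk : clAt r p α σ t k) (hj : clAt r p α σ t j)
    (hlt : settleTime σ t k < settleTime σ t j) : settleTime σ t k ≤ r j := by
  by_contra! hc
  have h1 := halg.workDone_eq_of_release_lt hinst hk hc
  exact absurd (halg.sched.settleTime_le (hinst.r_nonneg j) (hinst.workDone_pos hj) h1.symm)
    (not_le.2 hlt)

theorem settleTime_injOn (hinst : IsInstance r p α) (halg : IsALG r p α σ) (t : ℝ) :
    InjOn (settleTime σ t) {k | clAt r p α σ t k} := by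
  intro j hj k hk he
  by_contra hne
  have h1 := halg.remT_lt_of_release_lt hinst hk hne
    ((halg.release_lt_settleTime hinst hj).trans_eq he) ((halg.clAt_iff hinst t j).1 hj).2
  have h2 := halg.remT_lt_of_release_lt hinst hj (Ne.symm hne)
    ((halg.release_lt_settleTime hinst hk).trans_eq he.symm) ((halg.clAt_iff hinst t k).1 hk).2
  exact lt_asymm h1 h2

theorem remT_le_of_settleTime_le (hinst : IsInstance r p α) (halg : IsALG r p α σ) {t : ℝ}
    {j k : J} (hk : clAt r p α σ t k) (hj : clAt r p α σ t j)
    (hle : settleTime σ t k ≤ settleTime σ t j) : remT p σ j t ≤ remT p σ k t := by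
  rcases eq_or_ne k j with rfl | hne
  · exact le_rfl
  · exact (halg.remT_lt_of_release_lt hinst hj hne
      ((halg.release_lt_settleTime hinst hk).trans_le hle) ((halg.clAt_iff hinst t k).1 hk).2).le

/-- A job released after the settling time of a clairvoyant job `k` receives at most
`remT k / (1 - α)` units of work. -/
theorem workDone_le_of_settleTime_le (hinst : IsInstance r p α) (halg : IsALG r p α σ) {t : ℝ}
    {i k : J} (hk : clAt r p α σ t k) (hi : settleTime σ t k ≤ r i) :
    workDone σ i t ≤ 1 / (1 - α) * remT p σ k t := by
  have hs := halg.sched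
  have hmono := hs.workDone_mono
  have hα := hinst.alpha_mem
  have hα' : 0 < 1 - α := sub_pos.2 hα.2
  have hypos := hinst.workDone_pos hk
  have hTk := hs.workDone_settleTime (hinst.r_nonneg k) hypos
  have hkt := ((halg.clAt_iff hinst t k).1 hk).2
  have hR : 0 < remT p σ k t := sub_pos.2 hkt
  have hstep : ∀ x, 0 ≤ x → x < workDone σ i t → x < α * p i →
      (1 - α) * x ≤ α * remT p σ k t := by
    intro x hx0 hxt hxp
    have h0 : workDone σ i (r i) = 0 := hs.workDone_eq_zero (hinst.r_nonneg i) le_rfl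
    obtain ⟨z, hxz, hz⟩ := exists_between (lt_min hxt hxp)
    have hrt : r i ≤ t := (hs.release_lt (hinst.r_nonneg i) (hx0.trans_lt hxt)).le
    obtain ⟨a, ha, hax⟩ := intermediate_value_Icc hrt (hs.workDone_continuous i).continuousOn
      (show x ∈ Icc (workDone σ i (r i)) (workDone σ i t) from ⟨by rw [h0]; exact hx0, hxt.le⟩)
    obtain ⟨b, hb, hbz⟩ := intermediate_value_Icc hrt (hs.workDone_continuous i).continuousOn
      (show z ∈ Icc (workDone σ i (r i)) (workDone σ i t) from
        ⟨by rw [h0]; exact hx0.trans hxz.le, (hz.trans_le (min_le_left _ _)).le⟩)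
    obtain ⟨u, hu, hproc⟩ := hs.exists_procAt (j := i) (a := a) (b := b) (by rwa [hax, hbz])
    have hTu : settleTime σ t k ≤ u := hi.trans (ha.1.trans hu.1.le)
    have hut : u ≤ t := hu.2.le.trans hb.2
    have hku : workDone σ k u = workDone σ k t :=
      le_antisymm (hmono k hut) (hTk.symm.trans_le (hmono k hTu))
    have hclk : clAt r p α σ u k := (halg.clAt_iff hinst u k).2 (by rw [hku]; exact ⟨hk.2, hkt⟩)
    have hxu : x ≤ workDone σ i u := hax.symm.trans_le (hmono i hu.1.le)
    have hup : workDone σ i u < α * p i :=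
      ((hmono i hu.2.le).trans_eq hbz).trans_lt (hz.trans_le (min_le_right _ _))
    rcases halg.procAt_cases ⟨k, hclk.1⟩ hproc with h | h
    · exact absurd h.2.1.1.2 (not_lt.2 hup.le)
    · have h1 : ∃ j, ncAt r p α σ u j ∧ (1 - α) / α * workDone σ j u < remT p σ k u := by
        by_contra! hc
        exact h.1 ⟨k, hclk, hc⟩
      obtain ⟨j, hj, hjlt⟩ := h1
      have h2 : (1 - α) * x ≤ (1 - α) * workDone σ j u :=
        mul_le_mul_of_nonneg_left (hxu.trans (h.2.2 j hj)) hα'.le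
      rw [div_mul_eq_mul_div, div_lt_iff₀ hα.1] at hjlt
      have h3 : remT p σ k u = remT p σ k t := by unfold remT; rw [hku]
      rw [h3] at hjlt
      linarith
  have hmin : (1 - α) * min (workDone σ i t) (α * p i) ≤ α * remT p σ k t := by
    by_contra! hc
    have hmpos : 0 < min (workDone σ i t) (α * p i) := by
      by_contra! hm
      have := mul_nonpos_of_nonneg_of_nonpos hα'.le hm
      linarith [mul_pos hα.1 hR]
    have hlt : max 0 (α * remT p σ k t / (1 - α)) < min (workDone σ i t) (α * p i) := by
      refine max_lt hmpos ?_
      rw [div_lt_iff₀ hα']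
      linarith
    obtain ⟨x, hx1, hx2⟩ := exists_between hlt
    have h1 := hstep x ((le_max_left _ _).trans hx1.le) (hx2.trans_le (min_le_left _ _))
      (hx2.trans_le (min_le_right _ _))
    have h2 := (le_max_right _ _).trans_lt hx1
    rw [div_lt_iff₀ hα'] at h2
    linarith
  rw [div_mul_eq_mul_div, one_mul, le_div_iff₀ hα']
  rcases min_cases (workDone σ i t) (α * p i) with h | h
  · rw [h.1] at hmin
    nlinarith
  · rw [h.1] at hmin
    have h1 : (1 - α) * p i ≤ remT p σ k t := by
      refine le_of_mul_le_mul_left ?_ hα.1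
      linarith
    have h2 := mul_le_mul_of_nonneg_left (hs.workDone_le t i) hα'.le
    linarith

/-- From the settling time of a clairvoyant job on, all work goes to jobs released afterwards. -/
theorem sub_settleTime_le (hinst : IsInstance r p α) (halg : IsALG r p α σ) {t : ℝ} {k : J}
    (hk : clAt r p α σ t k) :
    t - settleTime σ t k ≤ ∑ j with settleTime σ t k ≤ r j, workDone σ j t := by
  have hs := halg.sched
  refine hs.sub_le_sum_workDone hinst.r_nonneg
    (hs.settleTime_le (hinst.r_nonneg k) (hinst.workDone_pos hk) rfl) (fun u hu => ?_)
    fun j hj => halg.workDone_eq_of_release_lt hinst hk hj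
  refine halg.nonidling u ⟨k, (hs.availAt_iff u k).2 ⟨?_, ?_⟩⟩
  · exact ((halg.release_lt_settleTime hinst hk).trans hu.1).le
  · exact (hs.workDone_mono k hu.2.le).trans_lt ((halg.clAt_iff hinst t k).1 hk).2

/-- The start `θ` of the busy period containing `t`. -/
theorem exists_busy_start (hinst : IsInstance r p α) (halg : IsALG r p α σ) {t : ℝ}
    (ht : 0 ≤ t) :
    ∃ θ ≤ t, t - θ ≤ ∑ j with θ ≤ r j, workDone σ j t ∧
      ∀ j, workDone σ j t < p j → θ ≤ r j := by
  have hs := halg.sched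
  set S : Set ℝ := insert 0 {u | u ∈ Icc 0 t ∧ ¬ ∃ i, availAt r p σ u i} with hS
  have hSt : ∀ u ∈ S, u ≤ t := by
    rintro u (rfl | hu)
    · exact ht
    · exact hu.1.2
  have hbdd : BddAbove S := ⟨t, hSt⟩
  have hne : S.Nonempty := ⟨0, mem_insert _ _⟩
  have hle : sSup S ≤ t := csSup_le hne hSt
  have hdone : ∀ j, r j < sSup S → workDone σ j (sSup S) = p j := by
    intro j hj
    obtain ⟨u, hu, hju⟩ := exists_lt_of_lt_csSup hne hj
    rcases hu with rfl | hu
    · exact absurd hju (not_lt.2 (hinst.r_nonneg j))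
    · have h1 : p j ≤ workDone σ j u := by
        by_contra! hc
        exact hu.2 ⟨j, (hs.availAt_iff u j).2 ⟨hju.le, hc⟩⟩
      exact le_antisymm (hs.workDone_le _ j)
        (h1.trans (hs.workDone_mono j (le_csSup hbdd (Or.inr hu))))
  have hfin : ∀ j, r j < sSup S → workDone σ j t = p j := fun j hj =>
    le_antisymm (hs.workDone_le t j) ((hdone j hj).symm.trans_le (hs.workDone_mono j hle))
  refine ⟨sSup S, hle, hs.sub_le_sum_workDone hinst.r_nonneg hle (fun u hu => ?_)
    (fun j hj => (hfin j hj).trans (hdone j hj).symm), fun j hj => ?_⟩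
  · refine halg.nonidling u ?_
    by_contra hc
    have h0 : 0 ≤ u := (le_csSup hbdd (mem_insert _ _)).trans hu.1.le
    exact absurd (le_csSup hbdd (Or.inr ⟨⟨h0, hu.2.le⟩, hc⟩)) (not_le.2 hu.1)
  · by_contra! hc
    exact hj.ne (hfin j hc)

/-- For each clairvoyant job `k` there is a starting time separating `k` and the clairvoyant jobs
settling later from those settling before `k`. -/
theorem exists_start (hinst : IsInstance r p α) (halg : IsALG r p α σ) {t : ℝ} (ht : 0 ≤ t)
    (k : J) :
    ∃ θ ≤ t, t - θ ≤ ∑ j with θ ≤ r j, workDone σ j t ∧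
      (∀ j, clAt r p α σ t j → settleTime σ t k ≤ settleTime σ t j → θ ≤ r j) ∧
      ∀ j, clAt r p α σ t j → settleTime σ t j < settleTime σ t k → settleTime σ t j ≤ θ := by
  have hs := halg.sched
  set P : Finset J := {j | clAt r p α σ t j ∧ settleTime σ t j < settleTime σ t k} with hP
  rcases P.eq_empty_or_nonempty with he | hne
  · obtain ⟨θ, h1, h2, h3⟩ := halg.exists_busy_start hinst ht
    refine ⟨θ, h1, h2, fun j hj _ => h3 j ((halg.clAt_iff hinst t j).1 hj).2, fun j hj hlt => ?_⟩
    have : j ∈ P := by simp [hP, hj, hlt]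
    simp [he] at this
  · obtain ⟨l, hl, hmax⟩ := P.exists_max_image (settleTime σ t) hne
    have hl' : clAt r p α σ t l ∧ settleTime σ t l < settleTime σ t k := by simpa [hP] using hl
    refine ⟨settleTime σ t l,
      hs.settleTime_le (hinst.r_nonneg l) (hinst.workDone_pos hl'.1) rfl,
      halg.sub_settleTime_le hinst hl'.1,
      fun j hj hle => halg.settleTime_le_release hinst hl'.1 hj (hl'.2.trans_le hle),
      fun j hj hlt => hmax j ?_⟩
    simp [hP, hj, hlt]

end IsALG

/-- If `σ` devotes `[θ, t]` to jobs released from `θ` on, then the remaining work under `σ` of such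
jobs that are finished under `σO` is covered by the work of `σ` on jobs unfinished under `σO`. -/
theorem IsSchedule.sum_remT_le {J : Type*} [Fintype J] {r p : J → ℝ} {σ σO : ℝ → J → ℝ}
    (hs : IsSchedule r p σ) (hO : IsSchedule r p σO) (hr : ∀ j, 0 ≤ r j) {θ t : ℝ} (hθ : θ ≤ t)
    (hwork : t - θ ≤ ∑ j with θ ≤ r j, workDone σ j t) :
    ∑ j with (r j ≤ t ∧ ¬ availAt r p σO t j) ∧ θ ≤ r j, remT p σ j t ≤
      ∑ i with availAt r p σO t i ∧ θ ≤ r i, workDone σ i t := by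
  have hle : ∑ j with θ ≤ r j, workDone σO j t ≤ t - θ :=
    hO.sum_workDone_le hr hθ fun j hj => (Finset.mem_filter.1 hj).2
  have h := hle.trans hwork
  simp only [Finset.sum_filter] at h ⊢
  rw [← sub_nonneg, ← Finset.sum_sub_distrib] at h ⊢
  refine h.trans (Finset.sum_le_sum fun j _ => ?_)
  have h0 := hO.workDone_nonneg (hr j) t
  have hOj := hO.availAt_iff t j
  by_cases hθj : θ ≤ r j
  · by_cases hav : availAt r p σO t j
    · simp [hθj, hav, h0]
    · by_cases hrj : r j ≤ t
      · have h1 : p j ≤ workDone σO j t := by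
          by_contra! hc
          exact hav (hOj.2 ⟨hrj, hc⟩)
        simp only [hθj, hav, hrj, remT]
        simp
        linarith
      · have h1 := hs.workDone_eq_zero (hr j) (not_le.1 hrj).le
        simp [hθj, hav, hrj, h1, h0]
  · simp [hθj]

/-- If the demands `R` of the elements of `B` settling from time `T k` on are covered by supplies
`y` available from `T k` on, and each such supply is at most `β * R k`, then `B` has at most
`β` times as many elements as there are suppliers. -/
theorem card_le_mul_card_of_suffix_cover {ι : Type*} {β : ℝ} (hβ : 0 ≤ β) (O : Finset ι)
    {ρ y T R : ι → ℝ} (B : Finset ι) (hinj : InjOn T B) (hR : ∀ k ∈ B, 0 < R k)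
    (hanti : ∀ k ∈ B, ∀ j ∈ B, T k ≤ T j → R j ≤ R k)
    (hy : ∀ k ∈ B, ∀ i ∈ O, T k ≤ ρ i → y i ≤ β * R k)
    (hcov : ∀ k ∈ B, ∑ j ∈ B with T k ≤ T j, R j ≤ ∑ i ∈ O with T k ≤ ρ i, y i) :
    (B.card : ℝ) ≤ β * O.card := by
  have key : ∀ τ c, (∀ j ∈ B, τ ≤ T j ∧ R j ≤ c) → (∀ i ∈ O, τ ≤ ρ i → y i ≤ β * c) →
      ∑ i ∈ O with τ ≤ ρ i, y i - ∑ j ∈ B, R j ≤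
        c * (β * (O.filter fun i => τ ≤ ρ i).card - B.card) := by
    induction B using Finset.induction_on_min_value T with
    | empty =>
      intro τ c _ hyc
      have := Finset.sum_le_card_nsmul (O.filter fun i => τ ≤ ρ i) y (β * c) fun i hi =>
        hyc i (Finset.mem_filter.1 hi).1 (Finset.mem_filter.1 hi).2
      rw [nsmul_eq_mul] at this
      simp only [Finset.sum_empty, Finset.card_empty, Nat.cast_zero, sub_zero]
      linarith
    | insert a s ha hmin ih =>
      intro τ c hB hyc
      have hmem : a ∈ insert a s := Finset.mem_insert_self a s
      have hsub : ∀ {k}, k ∈ s → k ∈ insert a s := fun hk => Finset.mem_insert_of_mem hk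
      have h1 := ih (hinj.mono (by simp)) (fun k hk => hR k (hsub hk))
        (fun k hk j hj => hanti k (hsub hk) j (hsub hj)) (fun k hk => hy k (hsub hk))
        (fun k hk => by
          have h2 := hcov k (hsub hk)
          have hlt : ¬ T k ≤ T a := fun hle =>
            ha (hinj (hsub hk) hmem (le_antisymm hle (hmin k hk)) ▸ hk)
          rwa [Finset.filter_insert, if_neg hlt] at h2)
        (T a) (R a) (fun j hj => ⟨hmin j hj, hanti a hmem j (hsub hj) (hmin j hj)⟩)
        (hy a hmem)
      have h2 := hcov a hmem
      rw [Finset.filter_true_of_mem (by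
        intro j hj
        rcases Finset.mem_insert.1 hj with rfl | hj
        · exact le_rfl
        · exact hmin j hj)] at h2
      rw [Finset.sum_insert ha] at h2 ⊢
      rw [Finset.card_insert_of_notMem ha]
      have hτa := (hB a hmem).1
      have hRc := (hB a hmem).2
      have hRa := hR a hmem
      set Oa := O.filter fun i => T a ≤ ρ i with hOa
      set Oτ := O.filter fun i => τ ≤ ρ i with hOτ
      have hss : Oa ⊆ Oτ := fun i hi =>
        Finset.mem_filter.2 ⟨(Finset.mem_filter.1 hi).1, hτa.trans (Finset.mem_filter.1 hi).2⟩
      have h3 := Finset.sum_le_card_nsmul (Oτ \ Oa) y (β * c) fun i hi =>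
        hyc i (Finset.mem_filter.1 (Finset.mem_sdiff.1 hi).1).1
          (Finset.mem_filter.1 (Finset.mem_sdiff.1 hi).1).2
      rw [nsmul_eq_mul] at h3
      have h4 := Finset.sum_sdiff (f := y) hss
      have h5 : ((Oτ \ Oa).card : ℝ) + Oa.card = Oτ.card :=
        mod_cast Finset.card_sdiff_add_card_eq_card hss
      have h6 : 0 ≤ R a * (β * Oa.card - s.card - 1) := by linarith
      have h7 : 0 ≤ β * Oa.card - s.card - 1 := nonneg_of_mul_nonneg_right h6 hRa
      have h8 := mul_le_mul_of_nonneg_right hRc h7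
      push_cast
      rw [← h5]
      linarith
  rcases B.eq_empty_or_nonempty with rfl | hne
  · simpa using mul_nonneg hβ (Nat.cast_nonneg _)
  · obtain ⟨a, ha, hmin⟩ := B.exists_min_image T hne
    have h1 := key (T a) (R a) (fun j hj => ⟨hmin j hj, hanti a ha j hj (hmin j hj)⟩) (hy a ha)
    have h2 := hcov a ha
    rw [Finset.filter_true_of_mem hmin] at h2
    have h3 : 0 ≤ R a * (β * (O.filter fun i => T a ≤ ρ i).card - B.card) := by linarith
    have h4 := nonneg_of_mul_nonneg_right h3 (hR a ha)
    have h5 : ((O.filter fun i => T a ≤ ρ i).card : ℝ) ≤ O.card :=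
      mod_cast Finset.card_filter_le _ _
    have h6 := mul_le_mul_of_nonneg_left h5 hβ
    linarith

/-- For an ALG-schedule `σ` and any schedule `σO`,
`|Cl(t) ∖ O(t)| ≤ (1 + 1/(1-α))·|O(t)|` for all `t ≥ 0`. -/
theorem stmt8 {J : Type*} [Fintype J] {r p : J → ℝ} {α : ℝ} {σ σO : ℝ → J → ℝ}
    (hinst : IsInstance r p α) (halg : IsALG r p α σ) (hO : IsSchedule r p σO)
    (t : ℝ) (ht : 0 ≤ t) :
    (({j | clAt r p α σ t j ∧ ¬ availAt r p σO t j} : Set J).ncard : ℝ)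
      ≤ (1 + 1 / (1 - α)) * (({j | availAt r p σO t j} : Set J).ncard : ℝ) := by
  have hs := halg.sched
  have hr := hinst.r_nonneg
  have hα' : 0 < 1 - α := sub_pos.2 hinst.alpha_mem.2
  set T := settleTime σ t with hT
  set O : Finset J := {i | availAt r p σO t i} with hOdef
  set D : Finset J := {j | clAt r p α σ t j ∧ ¬ availAt r p σO t j} with hD
  have hmemO : ∀ i, i ∈ O ↔ availAt r p σO t i := fun i => by simp [hOdef]
  have hmemD : ∀ j, j ∈ D ↔ clAt r p α σ t j ∧ ¬ availAt r p σO t j := fun j => by simp [hD]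
  have hOcard : ({j | availAt r p σO t j} : Set J).ncard = O.card := by
    rw [← Set.ncard_coe_finset]
    congr 1
    ext i
    simp [hmemO]
  have hDcard : ({j | clAt r p α σ t j ∧ ¬ availAt r p σO t j} : Set J).ncard = D.card := by
    rw [← Set.ncard_coe_finset]
    congr 1
    ext j
    simp [hmemD]
  rw [hOcard, hDcard]
  have hinj : InjOn T {k | clAt r p α σ t k} := halg.settleTime_injOn hinst t
  -- `i` is released in the period between `k` and its predecessor in the settling order.
  let own : J → J → Prop := fun k i =>
    i ∈ O ∧ r i < T k ∧ ∀ l, clAt r p α σ t l → T l < T k → T l ≤ r i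
  have hA : (D.filter fun k => ∃ i, own k i).card ≤ O.card := by
    refine Finset.card_le_card_of_forall_subsingleton own
      (fun k hk => ?_) (fun i _ k hk l hl => ?_)
    · obtain ⟨i, hi⟩ := (Finset.mem_filter.1 hk).2
      exact ⟨i, hi.1, hi⟩
    · have hkc := ((hmemD k).1 (Finset.mem_filter.1 hk.1).1).1
      have hlc := ((hmemD l).1 (Finset.mem_filter.1 hl.1).1).1
      refine hinj hkc hlc (le_antisymm ?_ ?_)
      · by_contra! hlt
        exact absurd (hk.2.2.2 l hlc hlt) (not_le.2 hl.2.2.1)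
      · by_contra! hlt
        exact absurd (hl.2.2.2 k hkc hlt) (not_le.2 hk.2.2.1)
  have hB : ((D.filter fun k => ¬ ∃ i, own k i).card : ℝ) ≤ 1 / (1 - α) * O.card := by
    have hcl : ∀ k ∈ D.filter (fun k => ¬ ∃ i, own k i), clAt r p α σ t k := fun k hk =>
      ((hmemD k).1 (Finset.mem_filter.1 hk).1).1
    have hrem : ∀ k, clAt r p α σ t k → 0 < remT p σ k t := fun k hk =>
      sub_pos.2 ((halg.clAt_iff hinst t k).1 hk).2
    refine card_le_mul_card_of_suffix_cover (ρ := r) (y := fun i => workDone σ i t) (T := T)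
      (R := fun k => remT p σ k t) (one_div_pos.2 hα').le O _ (hinj.mono hcl)
      (fun k hk => hrem k (hcl k hk))
      (fun k hk j hj => halg.remT_le_of_settleTime_le hinst (hcl k hk) (hcl j hj))
      (fun k hk i _ => halg.workDone_le_of_settleTime_le hinst (hcl k hk)) fun k hk => ?_
    obtain ⟨θ, hθ, hwork, hlater, hearlier⟩ := halg.exists_start hinst ht k
    refine le_trans ?_ ((hs.sum_remT_le hO hr hθ hwork).trans ?_)
    · refine Finset.sum_le_sum_of_subset_of_nonneg (fun j hj => ?_) fun j _ _ =>
        sub_nonneg.2 (hs.workDone_le t j)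
      obtain ⟨hj, hkj⟩ := Finset.mem_filter.1 hj
      have hjD := (hmemD j).1 (Finset.mem_filter.1 hj).1
      exact Finset.mem_filter.2
        ⟨Finset.mem_univ j, ⟨hjD.1.1.1, hjD.2⟩, hlater j hjD.1 hkj⟩
    · refine Finset.sum_le_sum_of_subset_of_nonneg (fun i hi => ?_) fun i _ _ =>
        hs.workDone_nonneg (hr i) t
      obtain ⟨hiO, hθi⟩ := (Finset.mem_filter.1 hi).2
      refine Finset.mem_filter.2 ⟨(hmemO i).2 hiO, ?_⟩
      by_contra! hlt
      exact (Finset.mem_filter.1 hk).2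
        ⟨i, (hmemO i).2 hiO, hlt, fun l hl hlk => (hearlier l hl hlk).trans hθi⟩
  have hsum : ((D.filter fun k => ∃ i, own k i).card : ℝ) +
      (D.filter fun k => ¬ ∃ i, own k i).card = D.card := by
    exact_mod_cast Finset.card_filter_add_card_filter_not (s := D) fun k => ∃ i, own k i
  have hA' : ((D.filter fun k => ∃ i, own k i).card : ℝ) ≤ O.card := mod_cast hA
  linarith
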